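/- Let μ ≥ ν > −1. The function f_{μ,ν} : [0, α_{ν,1}²) → ℝ defined by f_{μ,ν}(x) = (d/dx) log( x^{(ν−μ)/2} e^{(3x/4)(1/(μ+1) − 1/(ν+1))} d_μ(√x)/d_ν(√x) ) is absolutely monotonic on [0, α_{ν,1}²), i.e., f_{μ,ν}^{(m)}(x) ≥ 0 for all integers m ≥ 0 and all x ∈ [0, α_{ν,1}²). -/

import Mathlib

open Real Filter Set

/-- The Bessel function of the first kind of order `ν`, defined by its power series. -/
noncomputable def besselJ (ν x : ℝ) : ℝ :=
  ∑' n : ℕ, (-1 : ℝ) ^ n * x ^ (2 * (n : ℝ) + ν) /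
    (2 ^ (2 * (n : ℝ) + ν) * (n.factorial : ℝ) * Real.Gamma ((n : ℝ) + ν + 1))

/-- The Dini function `d_ν(x) = (1-ν) J_ν(x) + x J_ν'(x) = J_ν(x) - x J_{ν+1}(x)`. -/
noncomputable def dini (ν x : ℝ) : ℝ :=
  besselJ ν x - x * besselJ (ν + 1) x

/-- `p` is coefficientwise nonnegative and coefficientwise at most `q`. -/
def CoeffDominated (p q : PowerSeries ℝ) : Prop :=
  ∀ n, 0 ≤ PowerSeries.coeff n p ∧ PowerSeries.coeff n p ≤ PowerSeries.coeff n q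

namespace CoeffDominated

variable {p q p' q' : PowerSeries ℝ}

theorem add (h : CoeffDominated p q) (h' : CoeffDominated p' q') :
    CoeffDominated (p + p') (q + q') := fun n => by
  have := h n
  have := h' n
  simp only [map_add]
  constructor <;> linarith

/-- Domination of the coefficients of a product up to degree `n` of the factors. -/
theorem coeff_mul_le {n : ℕ}
    (h : ∀ i ≤ n, 0 ≤ PowerSeries.coeff i p ∧ PowerSeries.coeff i p ≤ PowerSeries.coeff i q)
    (h' : ∀ i ≤ n, 0 ≤ PowerSeries.coeff i p' ∧ PowerSeries.coeff i p' ≤ PowerSeries.coeff i q') :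
    0 ≤ PowerSeries.coeff n (p * p') ∧
      PowerSeries.coeff n (p * p') ≤ PowerSeries.coeff n (q * q') := by
  simp only [PowerSeries.coeff_mul]
  constructor
  · refine Finset.sum_nonneg fun i hi => ?_
    exact mul_nonneg (h _ (Finset.HasAntidiagonal.antidiagonal.fst_le hi)).1
      (h' _ (Finset.HasAntidiagonal.antidiagonal.snd_le hi)).1
  · refine Finset.sum_le_sum fun i hi => ?_
    have h₁ := h _ (Finset.HasAntidiagonal.antidiagonal.fst_le hi)
    have h₂ := h' _ (Finset.HasAntidiagonal.antidiagonal.snd_le hi)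
    exact mul_le_mul h₁.2 h₂.2 h₂.1 (h₁.1.trans h₁.2)

theorem mul (h : CoeffDominated p q) (h' : CoeffDominated p' q') :
    CoeffDominated (p * p') (q * q') := fun _ =>
  coeff_mul_le (fun i _ => h i) (fun i _ => h' i)

theorem X_mul (h : CoeffDominated p q) :
    CoeffDominated (PowerSeries.X * p) (PowerSeries.X * q) := fun n => by
  cases n with
  | zero => simp
  | succ n => simpa only [PowerSeries.coeff_succ_X_mul] using h n

theorem derivative (h : CoeffDominated p q) :
    CoeffDominated (PowerSeries.derivative ℝ p) (PowerSeries.derivative ℝ q) := fun n => by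
  simp only [PowerSeries.coeff_derivative]
  have := h (n + 1)
  exact ⟨mul_nonneg this.1 (by positivity), mul_le_mul_of_nonneg_right this.2 (by positivity)⟩

/-- Coefficientwise domination passes to solutions of `g = 1 + X * p * g`. -/
theorem of_eq_one_add {g g' : PowerSeries ℝ} (h : CoeffDominated p q)
    (hg : g = 1 + PowerSeries.X * (p * g)) (hg' : g' = 1 + PowerSeries.X * (q * g')) :
    CoeffDominated g g' := fun n => by
  induction n using Nat.strong_induction_on with
  | _ n ih =>
    rw [hg, hg']
    cases n with
    | zero => simp
    | succ n =>
      simp only [map_add, PowerSeries.coeff_succ_X_mul, PowerSeries.coeff_one,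
        Nat.succ_ne_zero, if_false, zero_add]
      exact coeff_mul_le (fun i _ => h i) (fun i hi => ih i (by omega))

/-- Coefficientwise domination for solutions of the Riccati equation
`X * w' + a * w = c + X * w ^ 2`, decreasing in `a`. -/
theorem of_riccati {w w' : PowerSeries ℝ} {a b c : ℝ} (ha : 0 < a) (hab : a ≤ b) (hc : 0 ≤ c)
    (hw : PowerSeries.X * PowerSeries.derivative ℝ w + PowerSeries.C b * w =
      PowerSeries.C c + PowerSeries.X * (w * w))
    (hw' : PowerSeries.X * PowerSeries.derivative ℝ w' + PowerSeries.C a * w' =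
      PowerSeries.C c + PowerSeries.X * (w' * w')) :
    CoeffDominated w w' := fun n => by
  have key : ∀ {x y s t e f : ℝ}, 0 < e → e ≤ f → f * x = s → e * y = t → 0 ≤ s → s ≤ t →
      0 ≤ x ∧ x ≤ y := by
    intro x y s t e f he hef hx hy hs hst
    have hf := he.trans_le hef
    have hx0 : 0 ≤ x := by
      by_contra! h
      nlinarith
    exact ⟨hx0, by nlinarith⟩
  induction n using Nat.strong_induction_on with
  | _ n ih =>
    cases n with
    | zero =>
      have h₁ := congrArg (PowerSeries.coeff 0) hw
      have h₂ := congrArg (PowerSeries.coeff 0) hw'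
      simp only [map_add (PowerSeries.coeff _), PowerSeries.coeff_zero_X_mul,
        PowerSeries.coeff_C_mul, zero_add,
        PowerSeries.coeff_zero_C, add_zero] at h₁ h₂
      exact key ha hab h₁ h₂ hc le_rfl
    | succ n =>
      have h₁ := congrArg (PowerSeries.coeff (n + 1)) hw
      have h₂ := congrArg (PowerSeries.coeff (n + 1)) hw'
      simp only [map_add (PowerSeries.coeff _), PowerSeries.coeff_succ_X_mul,
        PowerSeries.coeff_C_mul, PowerSeries.coeff_derivative, PowerSeries.coeff_C,
        Nat.succ_ne_zero, if_false,
        zero_add] at h₁ h₂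
      have h₃ := coeff_mul_le (p := w) (q := w') (p' := w) (q' := w') (n := n)
        (fun i hi => ih i (by omega)) (fun i hi => ih i (by omega))
      refine key (e := a + (n + 1)) (f := b + (n + 1)) (by positivity) (by linarith) ?_ ?_
        h₃.1 h₃.2
      · rw [← h₁]; ring
      · rw [← h₂]; ring

end CoeffDominated

/-- The power series in `s` of the normalized Bessel function, evaluated at `√s`. -/
noncomputable def besselSeries (ν : ℝ) : PowerSeries ℝ :=
  PowerSeries.mk fun n => (-1) ^ n * Real.Gamma (ν + 1) /
    (4 ^ n * n.factorial * Real.Gamma (n + ν + 1))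

/-- The power series in `s` of the normalized Dini function, evaluated at `√s`. -/
noncomputable def diniSeries (ν : ℝ) : PowerSeries ℝ :=
  besselSeries ν + 2 * PowerSeries.X * PowerSeries.derivative ℝ (besselSeries ν)

/-- The power series of the negative logarithmic derivative of `besselSeries`. -/
noncomputable def besselLogSeries (ν : ℝ) : PowerSeries ℝ :=
  -PowerSeries.derivative ℝ (besselSeries ν) * (besselSeries ν)⁻¹

/-- The power series of the negative logarithmic derivative of `diniSeries`. -/
noncomputable def diniLogSeries (ν : ℝ) : PowerSeries ℝ :=
  besselLogSeries ν + 2 * PowerSeries.derivative ℝ (PowerSeries.X * besselLogSeries ν) *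
    (1 - 2 * PowerSeries.X * besselLogSeries ν)⁻¹

section Formal

variable {ν : ℝ}

theorem gamma_natCast_add_ne_zero (hν : -1 < ν) (n : ℕ) : Real.Gamma (n + ν + 1) ≠ 0 := by
  have : (0 : ℝ) ≤ n := n.cast_nonneg
  exact (Real.Gamma_pos_of_pos (by linarith)).ne'

theorem coeff_zero_besselSeries (hν : -1 < ν) : PowerSeries.coeff 0 (besselSeries ν) = 1 := by
  have := gamma_natCast_add_ne_zero hν 0
  simp only [Nat.cast_zero, zero_add] at this
  simp [besselSeries, this]

theorem coeff_succ_besselSeries (hν : -1 < ν) (n : ℕ) :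
    (n + 1) * (n + ν + 1) * PowerSeries.coeff (n + 1) (besselSeries ν) =
      -(1 / 4) * PowerSeries.coeff n (besselSeries ν) := by
  have hn : (0 : ℝ) ≤ n := n.cast_nonneg
  have h0 : (n : ℝ) + ν + 1 ≠ 0 := by linarith
  have hG := gamma_natCast_add_ne_zero hν n
  have hf : (n.factorial : ℝ) ≠ 0 := by positivity
  have hrec : Real.Gamma ((n + 1 : ℕ) + ν + 1) = (n + ν + 1) * Real.Gamma (n + ν + 1) := by
    rw [← Real.Gamma_add_one h0]; push_cast; ring_nf
  simp only [besselSeries, PowerSeries.coeff_mk, hrec, Nat.factorial_succ]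
  push_cast
  field_simp
  ring

/-- Bessel's differential equation for `besselSeries`. -/
theorem besselSeries_ode (hν : -1 < ν) :
    PowerSeries.X * PowerSeries.derivative ℝ (PowerSeries.derivative ℝ (besselSeries ν)) +
      PowerSeries.C (ν + 1) * PowerSeries.derivative ℝ (besselSeries ν) +
        PowerSeries.C (1 / 4) * besselSeries ν = 0 := by
  ext n
  have h := coeff_succ_besselSeries hν n
  cases n with
  | zero =>
    simp only [map_add (PowerSeries.coeff _), PowerSeries.coeff_zero_X_mul, PowerSeries.coeff_C_mul,
      PowerSeries.coeff_derivative, map_zero]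
    push_cast at h ⊢
    linarith
  | succ n =>
    simp only [map_add (PowerSeries.coeff _), PowerSeries.coeff_succ_X_mul, PowerSeries.coeff_C_mul,
      PowerSeries.coeff_derivative, map_zero]
    push_cast at h ⊢
    linarith

theorem besselSeries_mul_inv (hν : -1 < ν) : besselSeries ν * (besselSeries ν)⁻¹ = 1 :=
  PowerSeries.mul_inv_cancel _ (by
    rw [← PowerSeries.coeff_zero_eq_constantCoeff_apply, coeff_zero_besselSeries hν]
    exact one_ne_zero)

theorem besselSeries_ne_zero (hν : -1 < ν) : besselSeries ν ≠ 0 := fun h => by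
  simpa [h] using besselSeries_mul_inv hν

theorem besselLogSeries_mul (hν : -1 < ν) :
    besselLogSeries ν * besselSeries ν = -PowerSeries.derivative ℝ (besselSeries ν) := by
  have := besselSeries_mul_inv hν
  rw [besselLogSeries]
  linear_combination -PowerSeries.derivative ℝ (besselSeries ν) * this

theorem besselLogSeries_riccati (hν : -1 < ν) :
    PowerSeries.X * PowerSeries.derivative ℝ (besselLogSeries ν) +
      PowerSeries.C (ν + 1) * besselLogSeries ν =
        PowerSeries.C (1 / 4) + PowerSeries.X * (besselLogSeries ν * besselLogSeries ν) := by
  have h := besselLogSeries_mul hν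
  have h' := congrArg (PowerSeries.derivative ℝ) h
  rw [Derivation.leibniz, smul_eq_mul, smul_eq_mul, map_neg] at h'
  refine mul_right_cancel₀ (besselSeries_ne_zero hν) ?_
  linear_combination PowerSeries.X * h' - besselSeries_ode hν +
    (PowerSeries.C (ν + 1) - PowerSeries.X * besselLogSeries ν) * h

theorem one_sub_mul_inv :
    (1 - 2 * PowerSeries.X * besselLogSeries ν) *
      (1 - 2 * PowerSeries.X * besselLogSeries ν)⁻¹ = 1 :=
  PowerSeries.mul_inv_cancel _ (by simp)

theorem diniSeries_eq (hν : -1 < ν) :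
    diniSeries ν = besselSeries ν * (1 - 2 * PowerSeries.X * besselLogSeries ν) := by
  rw [diniSeries]
  linear_combination 2 * PowerSeries.X * besselLogSeries_mul hν

theorem diniSeries_ne_zero (hν : -1 < ν) : diniSeries ν ≠ 0 := by
  rw [diniSeries_eq hν]
  refine mul_ne_zero (besselSeries_ne_zero hν) fun h => ?_
  simpa [h] using one_sub_mul_inv (ν := ν)

theorem diniLogSeries_mul (hν : -1 < ν) :
    diniLogSeries ν * diniSeries ν = -PowerSeries.derivative ℝ (diniSeries ν) := by
  have h := besselLogSeries_mul hν
  have h₂ := one_sub_mul_inv (ν := ν)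
  have h₃ : PowerSeries.derivative ℝ (1 - 2 * PowerSeries.X * besselLogSeries ν) =
      -(2 * PowerSeries.derivative ℝ (PowerSeries.X * besselLogSeries ν)) := by
    rw [map_sub, PowerSeries.derivative_one, mul_assoc, zero_sub, two_mul, map_add, two_mul]
  rw [diniSeries_eq hν, Derivation.leibniz, smul_eq_mul, smul_eq_mul, h₃, diniLogSeries]
  linear_combination (1 - 2 * PowerSeries.X * besselLogSeries ν) * h +
    2 * PowerSeries.derivative ℝ (PowerSeries.X * besselLogSeries ν) * besselSeries ν * h₂

theorem coeff_zero_diniLogSeries (hν : -1 < ν) :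
    PowerSeries.coeff 0 (diniLogSeries ν) = 3 / 4 * (1 / (ν + 1)) := by
  have h₁ := congrArg (PowerSeries.coeff 0) (besselLogSeries_riccati hν)
  have h0 : ν + 1 ≠ 0 := by linarith
  simp only [map_add (PowerSeries.coeff _), PowerSeries.coeff_zero_X_mul,
        PowerSeries.coeff_C_mul, zero_add,
    PowerSeries.coeff_zero_C, add_zero] at h₁
  have h₂ : PowerSeries.coeff 0 (besselLogSeries ν) = 1 / 4 * (1 / (ν + 1)) := by
    field_simp
    linarith
  have h₃ : PowerSeries.constantCoeff
      (PowerSeries.derivative ℝ (PowerSeries.X * besselLogSeries ν)) =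
        PowerSeries.coeff 0 (besselLogSeries ν) := by
    rw [← PowerSeries.coeff_zero_eq_constantCoeff_apply, PowerSeries.coeff_derivative,
      PowerSeries.coeff_succ_X_mul]
    simp
  rw [diniLogSeries, map_add, h₂, PowerSeries.coeff_zero_eq_constantCoeff_apply]
  have h₄ : PowerSeries.constantCoeff (2 : PowerSeries ℝ) = 2 := map_ofNat _ 2
  simp only [map_mul, map_sub, map_one, h₃, h₂, h₄, PowerSeries.constantCoeff_inv,
    PowerSeries.constantCoeff_X]
  ring

theorem diniLogSeries_dominated {μ : ℝ} (hν : -1 < ν) (hμν : ν ≤ μ) :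
    CoeffDominated (diniLogSeries μ) (diniLogSeries ν) := by
  have hμ : -1 < μ := by linarith
  have hw : CoeffDominated (besselLogSeries μ) (besselLogSeries ν) :=
    .of_riccati (by linarith) (by linarith) (by norm_num) (besselLogSeries_riccati hμ)
      (besselLogSeries_riccati hν)
  have hq : CoeffDominated (1 - 2 * PowerSeries.X * besselLogSeries μ)⁻¹
      (1 - 2 * PowerSeries.X * besselLogSeries ν)⁻¹ := by
    refine (hw.add hw).of_eq_one_add ?_ ?_
    · linear_combination one_sub_mul_inv (ν := μ)
    · linear_combination one_sub_mul_inv (ν := ν)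
  have hd := hw.X_mul.derivative
  have hd₂ := hd.add hd
  rw [← two_mul, ← two_mul] at hd₂
  exact hw.add (hd₂.mul hq)

end Formal

/-- The Taylor series at `0`. -/
noncomputable def taylorAtZero (f : ℝ → ℝ) : PowerSeries ℝ :=
  PowerSeries.mk fun n => iteratedDeriv n f 0 / n.factorial

section Taylor

variable {f g : ℝ → ℝ}

theorem taylorAtZero_congr (h : f =ᶠ[nhds 0] g) : taylorAtZero f = taylorAtZero g := by
  ext n
  simp only [taylorAtZero, PowerSeries.coeff_mk, h.iteratedDeriv_eq n]

theorem taylorAtZero_add (hf : AnalyticAt ℝ f 0) (hg : AnalyticAt ℝ g 0) :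
    taylorAtZero (fun x => f x + g x) = taylorAtZero f + taylorAtZero g := by
  ext n
  simp only [taylorAtZero, PowerSeries.coeff_mk, map_add]
  rw [iteratedDeriv_fun_add hf.contDiffAt hg.contDiffAt, add_div]

theorem taylorAtZero_neg : taylorAtZero (fun x => -f x) = -taylorAtZero f := by
  ext n
  simp only [taylorAtZero, PowerSeries.coeff_mk, map_neg]
  rw [iteratedDeriv_fun_neg, neg_div]

theorem taylorAtZero_sub (hf : AnalyticAt ℝ f 0) (hg : AnalyticAt ℝ g 0) :
    taylorAtZero (fun x => f x - g x) = taylorAtZero f - taylorAtZero g := by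
  simp only [sub_eq_add_neg]
  rw [← taylorAtZero_neg]
  exact taylorAtZero_add hf hg.neg

theorem taylorAtZero_mul (hf : AnalyticAt ℝ f 0) (hg : AnalyticAt ℝ g 0) :
    taylorAtZero (fun x => f x * g x) = taylorAtZero f * taylorAtZero g := by
  ext n
  simp only [taylorAtZero, PowerSeries.coeff_mk, PowerSeries.coeff_mul]
  rw [iteratedDeriv_fun_mul hf.contDiffAt hg.contDiffAt, Finset.sum_div,
    Finset.Nat.sum_antidiagonal_eq_sum_range_succ
      (fun i j => iteratedDeriv i f 0 / i.factorial * (iteratedDeriv j g 0 / j.factorial))]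
  refine Finset.sum_congr rfl fun i hi => ?_
  rw [Nat.cast_choose ℝ (Finset.mem_range_succ_iff.mp hi)]
  field_simp

theorem taylorAtZero_deriv :
    taylorAtZero (deriv f) = PowerSeries.derivative ℝ (taylorAtZero f) := by
  ext n
  simp only [taylorAtZero, PowerSeries.coeff_mk, PowerSeries.coeff_derivative]
  rw [← iteratedDeriv_succ', Nat.factorial_succ]
  push_cast
  field_simp

theorem taylorAtZero_const (c : ℝ) : taylorAtZero (fun _ => c) = PowerSeries.C c := by
  ext n
  simp only [taylorAtZero, PowerSeries.coeff_mk, PowerSeries.coeff_C, iteratedDeriv_const]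
  split_ifs with h <;> simp [h]

theorem taylorAtZero_id : taylorAtZero (fun x => x) = PowerSeries.X := by
  have hd : PowerSeries.derivative ℝ (taylorAtZero fun x => x) =
      PowerSeries.derivative ℝ PowerSeries.X := by
    rw [← taylorAtZero_deriv, PowerSeries.derivative_X, deriv_id'', taylorAtZero_const, map_one]
  exact PowerSeries.derivative.ext hd (by simp [taylorAtZero])

theorem HasFPowerSeriesOnBall.exists_deriv {p : FormalMultilinearSeries ℝ ℝ ℝ} {x : ℝ}
    {r : ENNReal} (h : HasFPowerSeriesOnBall f p x r) :
    ∃ q : FormalMultilinearSeries ℝ ℝ ℝ, HasFPowerSeriesOnBall (deriv f) q x r :=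
  ⟨_, (ContinuousLinearMap.apply ℝ ℝ (1 : ℝ)).comp_hasFPowerSeriesOnBall h.fderiv⟩

theorem HasFPowerSeriesOnBall.exists_iteratedDeriv {p : FormalMultilinearSeries ℝ ℝ ℝ} {x : ℝ}
    {r : ENNReal} (h : HasFPowerSeriesOnBall f p x r) (n : ℕ) :
    ∃ q : FormalMultilinearSeries ℝ ℝ ℝ, HasFPowerSeriesOnBall (iteratedDeriv n f) q x r := by
  induction n with
  | zero => exact ⟨p, by simpa using h⟩
  | succ n ih =>
    obtain ⟨q, hq⟩ := ih
    rw [iteratedDeriv_succ]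
    exact hq.exists_deriv

theorem iteratedDeriv_iteratedDeriv (m n : ℕ) :
    iteratedDeriv m (iteratedDeriv n f) = iteratedDeriv (m + n) f := by
  simp only [iteratedDeriv_eq_iterate, Function.iterate_add_apply]

/-- If all derivatives of an analytic function are nonnegative at `t`, they remain so on a
right neighbourhood of `t`. -/
theorem exists_nonneg_iteratedDeriv_right {t : ℝ} (hf : AnalyticAt ℝ f t)
    (h : ∀ n, 0 ≤ iteratedDeriv n f t) :
    ∃ ε > 0, ∀ y ∈ Set.Ico 0 ε, ∀ n, 0 ≤ iteratedDeriv n f (t + y) := by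
  obtain ⟨p, r, hp⟩ := hf
  obtain ⟨ε, hε, hεr⟩ := ENNReal.lt_iff_exists_nnreal_btwn.mp hp.r_pos
  refine ⟨ε, by exact_mod_cast hε, fun y hy n => ?_⟩
  obtain ⟨q, hq⟩ := hp.exists_iteratedDeriv n
  have hy' : y ∈ Metric.eball (0 : ℝ) r := by
    refine lt_trans ?_ hεr
    rw [edist_dist, Real.dist_eq, sub_zero, abs_of_nonneg hy.1]
    rw [← ENNReal.ofReal_coe_nnreal]
    exact (ENNReal.ofReal_lt_ofReal_iff (by exact_mod_cast hε)).mpr hy.2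
  refine (hq.hasSum_iteratedFDeriv hy').nonneg fun m => ?_
  rw [iteratedFDeriv_apply_eq_iteratedDeriv_mul_prod, iteratedDeriv_iteratedDeriv]
  have := hy.1
  have := h (m + n)
  simp only [Finset.prod_const, smul_eq_mul]
  positivity

theorem analyticAt_iteratedDeriv {x : ℝ} (hf : AnalyticAt ℝ f x) (n : ℕ) :
    AnalyticAt ℝ (iteratedDeriv n f) x := by
  obtain ⟨p, r, hp⟩ := hf
  obtain ⟨q, hq⟩ := hp.exists_iteratedDeriv n
  exact hq.analyticAt

/-- An analytic function on `[0, A)` with nonnegative Taylor coefficients at `0` is absolutely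
monotonic on `[0, A)`. -/
theorem iteratedDeriv_nonneg_of_analytic {A : ℝ} (hf : ∀ x ∈ Set.Ico 0 A, AnalyticAt ℝ f x)
    (h0 : ∀ n, 0 ≤ iteratedDeriv n f 0) {x : ℝ} (hx : x ∈ Set.Ico 0 A) (n : ℕ) :
    0 ≤ iteratedDeriv n f x := by
  have key : Set.Icc 0 x ⊆ {t | ∀ n, 0 ≤ iteratedDeriv n f t} := by
    refine IsClosed.Icc_subset_of_forall_exists_gt ?_ h0 ?_
    · have : {t | ∀ n, 0 ≤ iteratedDeriv n f t} ∩ Set.Icc 0 x =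
          ⋂ n, Set.Icc 0 x ∩ (iteratedDeriv n f) ⁻¹' Set.Ici 0 := by
        ext t
        simp only [Set.mem_inter_iff, Set.mem_iInter, Set.mem_preimage, Set.mem_Ici,
          Set.mem_ofPred_eq]
        exact ⟨fun h n => ⟨h.2, h.1 n⟩, fun h => ⟨fun n => (h n).2, (h 0).1⟩⟩
      rw [this]
      refine isClosed_iInter fun n => ContinuousOn.preimage_isClosed_of_isClosed ?_
        isClosed_Icc isClosed_Ici
      exact fun t ht => (analyticAt_iteratedDeriv
        (hf t ⟨ht.1, ht.2.trans_lt hx.2⟩) n).continuousAt.continuousWithinAt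
    · rintro t ⟨ht, ht0, htx⟩ y hy
      obtain ⟨ε, hε, H⟩ := exists_nonneg_iteratedDeriv_right (hf t ⟨ht0, htx.trans hx.2⟩) ht
      have hy' : 0 < y - t := sub_pos.mpr hy
      have hm : 0 < min (y - t) (ε / 2) := by positivity
      refine ⟨t + min (y - t) (ε / 2), H _ ⟨hm.le, ?_⟩, by linarith, ?_⟩
      · exact (min_le_right _ _).trans_lt (by linarith)
      · linarith [min_le_left (y - t) (ε / 2)]
  exact key ⟨hx.1, le_rfl⟩ n

end Taylor

/-- The normalized Bessel function `Γ(ν+1) (2/√s)^ν J_ν(√s)`, entire in `s`. -/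
noncomputable def besselFun (ν s : ℝ) : ℝ :=
  ∑' n : ℕ, PowerSeries.coeff n (besselSeries ν) * s ^ n

/-- The normalized Dini function `Γ(ν+1) (2/√s)^ν d_ν(√s)`, entire in `s`. -/
noncomputable def diniFun (ν s : ℝ) : ℝ :=
  besselFun ν s - s * (1 / (2 * (ν + 1)) * besselFun (ν + 1) s)

/-- The negative logarithmic derivative of `diniFun`. -/
noncomputable def diniLog (ν s : ℝ) : ℝ := -deriv (diniFun ν) s / diniFun ν s

section Analytic

variable {ν : ℝ}

theorem hasFPowerSeriesOnBall_besselFun (hν : -1 < ν) :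
    HasFPowerSeriesOnBall (besselFun ν) (FormalMultilinearSeries.ofScalars ℝ
      fun n => PowerSeries.coeff n (besselSeries ν)) 0 ⊤ := by
  have hne : ∀ n, PowerSeries.coeff n (besselSeries ν) ≠ 0 := fun n => by
    have h₁ := gamma_natCast_add_ne_zero hν n
    have h₂ := gamma_natCast_add_ne_zero hν 0
    simp only [Nat.cast_zero, zero_add] at h₂
    rw [besselSeries, PowerSeries.coeff_mk]
    positivity
  have hratio : ∀ n : ℕ, ‖PowerSeries.coeff n.succ (besselSeries ν)‖ /
      ‖PowerSeries.coeff n (besselSeries ν)‖ = 1 / 4 / ((n + 1) * (n + ν + 1)) := fun n => by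
    have hn : (0 : ℝ) ≤ n := n.cast_nonneg
    have hpos : 0 < (n + 1) * (n + ν + 1) := mul_pos (by linarith) (by linarith)
    have h := congrArg norm (coeff_succ_besselSeries hν n)
    rw [norm_mul _ (PowerSeries.coeff _ _), norm_mul _ (PowerSeries.coeff _ _), norm_neg,
      Real.norm_of_nonneg hpos.le,
      Real.norm_of_nonneg (by norm_num : (0 : ℝ) ≤ 1 / 4)] at h
    rw [div_eq_div_iff (norm_ne_zero_iff.mpr (hne n)) hpos.ne']
    linarith
  have hlim : Filter.Tendsto (fun n : ℕ => ‖PowerSeries.coeff n.succ (besselSeries ν)‖ /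
      ‖PowerSeries.coeff n (besselSeries ν)‖) Filter.atTop (nhds 0) := by
    simp only [hratio]
    refine Filter.Tendsto.const_div_atTop ?_ _
    refine Filter.Tendsto.atTop_mul_atTop₀ ?_ ?_
    · exact Filter.tendsto_atTop_add_const_right _ _ tendsto_natCast_atTop_atTop
    · exact Filter.tendsto_atTop_add_const_right _ _
        (Filter.tendsto_atTop_add_const_right _ _ tendsto_natCast_atTop_atTop)
  have hrad := FormalMultilinearSeries.ofScalars_radius_eq_top_of_tendsto ℝ
    (fun n => PowerSeries.coeff n (besselSeries ν)) (Filter.Eventually.of_forall hne) hlim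
  have h := (FormalMultilinearSeries.ofScalars ℝ
    fun n => PowerSeries.coeff n (besselSeries ν)).hasFPowerSeriesOnBall (by simp [hrad])
  rw [hrad] at h
  refine h.congr fun s _ => ?_
  exact FormalMultilinearSeries.ofScalars_sum_eq _ s

theorem analyticAt_besselFun (hν : -1 < ν) (s : ℝ) : AnalyticAt ℝ (besselFun ν) s :=
  (hasFPowerSeriesOnBall_besselFun hν).analyticAt_of_mem (by simp)

theorem taylorAtZero_besselFun (hν : -1 < ν) : taylorAtZero (besselFun ν) = besselSeries ν := by
  have h := (analyticAt_besselFun hν 0).hasFPowerSeriesAt.eq_formalMultilinearSeries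
    (hasFPowerSeriesOnBall_besselFun hν).hasFPowerSeriesAt
  ext n
  simpa [taylorAtZero] using congrArg (fun p => FormalMultilinearSeries.coeff p n) h

theorem derivative_besselSeries (hν : -1 < ν) :
    PowerSeries.derivative ℝ (besselSeries ν) =
      -(PowerSeries.C (1 / (4 * (ν + 1))) * besselSeries (ν + 1)) := by
  ext n
  have h0 : ν + 1 ≠ 0 := by linarith
  have hG := gamma_natCast_add_ne_zero hν (n + 1)
  have hG' : Real.Gamma ((n : ℝ) + (ν + 1) + 1) = Real.Gamma ((n + 1 : ℕ) + ν + 1) := by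
    push_cast; ring_nf
  have hf : (n.factorial : ℝ) ≠ 0 := by positivity
  simp only [PowerSeries.coeff_derivative, map_neg, PowerSeries.coeff_C_mul, besselSeries,
    PowerSeries.coeff_mk, Nat.factorial_succ, hG', Real.Gamma_add_one h0]
  push_cast at hG ⊢
  field_simp
  ring

theorem analyticAt_diniFun (hν : -1 < ν) (s : ℝ) : AnalyticAt ℝ (diniFun ν) s :=
  (analyticAt_besselFun hν s).sub
    (analyticAt_id.mul (analyticAt_const.mul (analyticAt_besselFun (by linarith) s)))

theorem continuous_diniFun (hν : -1 < ν) : Continuous (diniFun ν) :=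
  continuous_iff_continuousAt.mpr fun s => (analyticAt_diniFun hν s).continuousAt

theorem taylorAtZero_diniFun (hν : -1 < ν) : taylorAtZero (diniFun ν) = diniSeries ν := by
  have hν' : -1 < ν + 1 := by linarith
  have h₁ := analyticAt_besselFun hν 0
  have h₂ := analyticAt_besselFun hν' 0
  have h₃ : AnalyticAt ℝ (fun s => 1 / (2 * (ν + 1)) * besselFun (ν + 1) s) 0 :=
    analyticAt_const.mul h₂
  have h₄ : AnalyticAt ℝ (fun s : ℝ => s) 0 := analyticAt_id
  have h₅ : AnalyticAt ℝ (fun s => s * (1 / (2 * (ν + 1)) * besselFun (ν + 1) s)) 0 := h₄.mul h₃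
  have hC : PowerSeries.C (1 / (2 * (ν + 1))) = 2 * PowerSeries.C (1 / (4 * (ν + 1))) := by
    rw [← map_ofNat PowerSeries.C 2, ← map_mul]
    congr 1
    have h0 : ν + 1 ≠ 0 := by linarith
    field_simp
    norm_num
  calc taylorAtZero (diniFun ν)
    _ = taylorAtZero (fun s => besselFun ν s - s * (1 / (2 * (ν + 1)) * besselFun (ν + 1) s)) := rfl
    _ = besselSeries ν - PowerSeries.X * (PowerSeries.C (1 / (2 * (ν + 1))) *
          besselSeries (ν + 1)) := by
      rw [taylorAtZero_sub h₁ h₅, taylorAtZero_mul h₄ h₃,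
        taylorAtZero_mul analyticAt_const h₂, taylorAtZero_id, taylorAtZero_const,
        taylorAtZero_besselFun hν, taylorAtZero_besselFun hν']
    _ = diniSeries ν := by
      rw [diniSeries, derivative_besselSeries hν, hC]
      ring

theorem diniFun_zero (hν : -1 < ν) : diniFun ν 0 = 1 := by
  have : PowerSeries.coeff 0 (taylorAtZero (besselFun ν)) = 1 := by
    rw [taylorAtZero_besselFun hν, coeff_zero_besselSeries hν]
  simpa [taylorAtZero, diniFun] using this

theorem analyticAt_diniLog (hν : -1 < ν) {s : ℝ} (hs : diniFun ν s ≠ 0) :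
    AnalyticAt ℝ (diniLog ν) s :=
  (analyticAt_diniFun hν s).deriv.neg.div (analyticAt_diniFun hν s) hs

theorem taylorAtZero_diniLog (hν : -1 < ν) : taylorAtZero (diniLog ν) = diniLogSeries ν := by
  have h0 : diniFun ν 0 ≠ 0 := by simp [diniFun_zero hν]
  have hD := analyticAt_diniFun hν 0
  refine mul_right_cancel₀ (diniSeries_ne_zero hν) ?_
  rw [diniLogSeries_mul hν, ← taylorAtZero_diniFun hν,
    ← taylorAtZero_mul (analyticAt_diniLog hν h0) hD, ← taylorAtZero_deriv, ← taylorAtZero_neg]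
  refine taylorAtZero_congr ?_
  filter_upwards [hD.continuousAt.eventually_ne h0] with s hs
  rw [diniLog, div_mul_cancel₀ _ hs]

theorem besselJ_sqrt (hν : -1 < ν) {s : ℝ} (hs : 0 < s) :
    besselJ ν (√s) = s ^ (ν / 2) / (2 ^ ν * Real.Gamma (ν + 1)) * besselFun ν s := by
  rw [besselJ, besselFun, ← tsum_mul_left]
  refine tsum_congr fun n => ?_
  have h₁ : (√s) ^ (2 * (n : ℝ) + ν) = s ^ n * s ^ (ν / 2) := by
    rw [Real.sqrt_eq_rpow, ← Real.rpow_mul hs.le, ← Real.rpow_natCast, ← Real.rpow_add hs]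
    ring_nf
  have h₂ : (2 : ℝ) ^ (2 * (n : ℝ) + ν) = 4 ^ n * 2 ^ ν := by
    rw [Real.rpow_add two_pos, Real.rpow_mul two_pos.le, Real.rpow_natCast]
    norm_num
  have hG := gamma_natCast_add_ne_zero hν n
  have hG₀ := gamma_natCast_add_ne_zero hν 0
  simp only [Nat.cast_zero, zero_add] at hG₀
  have h2 : (2 : ℝ) ^ ν ≠ 0 := (Real.rpow_pos_of_pos two_pos ν).ne'
  rw [h₁, h₂, besselSeries, PowerSeries.coeff_mk]
  field_simp

theorem dini_sqrt (hν : -1 < ν) {s : ℝ} (hs : 0 < s) :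
    dini ν (√s) = s ^ (ν / 2) / (2 ^ ν * Real.Gamma (ν + 1)) * diniFun ν s := by
  have h0 : ν + 1 ≠ 0 := by linarith
  have hG₀ := gamma_natCast_add_ne_zero hν 0
  simp only [Nat.cast_zero, zero_add] at hG₀
  have h₁ : √s * s ^ ((ν + 1) / 2) = s * s ^ (ν / 2) := by
    rw [Real.sqrt_eq_rpow, ← Real.rpow_add hs, ← Real.rpow_one_add' hs.le]
    · ring_nf
    · linarith
  have h2 : (2 : ℝ) ^ ν ≠ 0 := (Real.rpow_pos_of_pos two_pos ν).ne'
  rw [dini, besselJ_sqrt hν hs, besselJ_sqrt (by linarith) hs, diniFun, Real.Gamma_add_one h0,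
    Real.rpow_add_one two_ne_zero, ← mul_assoc, mul_div_assoc', h₁]
  field_simp

/-- The difference of the logarithmic derivatives of `diniFun μ` and `diniFun ν`, shifted by the
constant that makes it vanish at `0`. -/
noncomputable def diniLogDiff (μ ν s : ℝ) : ℝ :=
  3 / 4 * (1 / (μ + 1) - 1 / (ν + 1)) + (diniLog ν s - diniLog μ s)

variable {μ : ℝ}

theorem analyticAt_diniLogDiff (hμ : -1 < μ) (hν : -1 < ν) {s : ℝ} (hμs : diniFun μ s ≠ 0)
    (hνs : diniFun ν s ≠ 0) : AnalyticAt ℝ (diniLogDiff μ ν) s :=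
  analyticAt_const.add ((analyticAt_diniLog hν hνs).sub (analyticAt_diniLog hμ hμs))

theorem taylorAtZero_diniLogDiff (hμ : -1 < μ) (hν : -1 < ν) :
    taylorAtZero (diniLogDiff μ ν) =
      PowerSeries.C (3 / 4 * (1 / (μ + 1) - 1 / (ν + 1))) +
        (diniLogSeries ν - diniLogSeries μ) := by
  have h₁ := analyticAt_diniLog hμ (s := 0) (by simp [diniFun_zero hμ])
  have h₂ := analyticAt_diniLog hν (s := 0) (by simp [diniFun_zero hν])
  rw [← taylorAtZero_diniLog hμ, ← taylorAtZero_diniLog hν, ← taylorAtZero_sub h₂ h₁,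
    ← taylorAtZero_const]
  exact taylorAtZero_add analyticAt_const (h₂.sub h₁)

theorem coeff_zero_taylorAtZero_diniLogDiff (hμ : -1 < μ) (hν : -1 < ν) :
    PowerSeries.coeff 0 (taylorAtZero (diniLogDiff μ ν)) = 0 := by
  rw [taylorAtZero_diniLogDiff hμ hν, map_add, map_sub, coeff_zero_diniLogSeries hμ,
    coeff_zero_diniLogSeries hν, PowerSeries.coeff_zero_C]
  ring

theorem diniLogDiff_zero (hμ : -1 < μ) (hν : -1 < ν) : diniLogDiff μ ν 0 = 0 := by
  simpa [taylorAtZero] using coeff_zero_taylorAtZero_diniLogDiff hμ hν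

theorem iteratedDeriv_diniLogDiff_zero_nonneg (hν : -1 < ν) (hμν : ν ≤ μ) (n : ℕ) :
    0 ≤ iteratedDeriv n (diniLogDiff μ ν) 0 := by
  have hμ : -1 < μ := by linarith
  have hcoeff : 0 ≤ PowerSeries.coeff n (taylorAtZero (diniLogDiff μ ν)) := by
    cases n with
    | zero => exact (coeff_zero_taylorAtZero_diniLogDiff hμ hν).ge
    | succ n =>
      rw [taylorAtZero_diniLogDiff hμ hν, map_add, map_sub, PowerSeries.coeff_C]
      have := (diniLogSeries_dominated hν hμν (n + 1)).2
      simpa using this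
  rw [taylorAtZero, PowerSeries.coeff_mk] at hcoeff
  have hf : (0 : ℝ) < n.factorial := by positivity
  simpa [hf.ne'] using mul_nonneg hcoeff hf.le

/-- A continuous function that is positive at `0` and has no zero on `[0, A)` is positive there. -/
theorem pos_of_ne_zero_on_Ico {f : ℝ → ℝ} (hf : Continuous f) (h0 : 0 < f 0) {A : ℝ}
    (hne : ∀ x ∈ Set.Ico 0 A, f x ≠ 0) {x : ℝ} (hx : x ∈ Set.Ico 0 A) : 0 < f x := by
  by_contra! h
  obtain ⟨y, hy, hy0⟩ := intermediate_value_Icc' hx.1 hf.continuousOn ⟨h, h0.le⟩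
  exact hne y ⟨hy.1, hy.2.trans_lt hx.2⟩ hy0

theorem hasDerivAt_diniFun (hν : -1 < ν) {s : ℝ} (hs : diniFun ν s ≠ 0) :
    HasDerivAt (diniFun ν) (-(diniLog ν s * diniFun ν s)) s := by
  rw [diniLog, div_mul_cancel₀ _ hs, neg_neg]
  exact (analyticAt_diniFun hν s).differentiableAt.hasDerivAt

/-- The first positive zero of `diniFun` is increasing in the order. -/
theorem diniFun_pos_of_le (hν : -1 < ν) (hμν : ν ≤ μ) {A : ℝ}
    (hpos : ∀ x ∈ Set.Ico 0 A, 0 < diniFun ν x) {x : ℝ} (hx : x ∈ Set.Ico 0 A) :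
    0 < diniFun μ x := by
  have hμ : -1 < μ := by linarith
  refine pos_of_ne_zero_on_Ico (continuous_diniFun hμ) (by simp [diniFun_zero hμ]) ?_ hx
  intro z hz hz0
  obtain ⟨B, ⟨⟨hB0, hBz⟩, hB⟩, hmin⟩ :=
    (isCompact_Icc.inter_right (isClosed_singleton.preimage (continuous_diniFun hμ)) :
      IsCompact (Set.Icc 0 z ∩ diniFun μ ⁻¹' {0})).exists_isLeast ⟨z, ⟨hz.1, le_rfl⟩, hz0⟩
  have hBA : B < A := hBz.trans_lt hz.2
  have hμpos : ∀ y ∈ Set.Ico 0 B, 0 < diniFun μ y := fun y hy =>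
    pos_of_ne_zero_on_Ico (continuous_diniFun hμ) (by simp [diniFun_zero hμ])
      (fun w hw hw0 => hw.2.not_ge (hmin ⟨⟨hw.1, hw.2.le.trans hBz⟩, hw0⟩)) hy
  have hνpos : ∀ y ∈ Set.Icc 0 B, 0 < diniFun ν y := fun y hy =>
    hpos y ⟨hy.1, hy.2.trans_lt hBA⟩
  set c : ℝ := 3 / 4 * (1 / (μ + 1) - 1 / (ν + 1)) with hc
  have hmono : MonotoneOn (fun y => Real.exp (c * y) * diniFun μ y / diniFun ν y)
      (Set.Icc 0 B) := by
    refine monotoneOn_of_hasDerivWithinAt_nonneg (convex_Icc 0 B)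
      (f' := fun y => Real.exp (c * y) * diniFun μ y / diniFun ν y * diniLogDiff μ ν y) ?_ ?_ ?_
    · refine ContinuousOn.div ?_ (continuous_diniFun hν).continuousOn fun y hy => (hνpos y hy).ne'
      exact ((by fun_prop : Continuous fun y => Real.exp (c * y)).mul
        (continuous_diniFun hμ)).continuousOn
    · intro y hy
      rw [interior_Icc] at hy
      have h₁ := (hμpos y ⟨hy.1.le, hy.2⟩).ne'
      have h₂ := (hνpos y ⟨hy.1.le, hy.2.le⟩).ne'
      have hexp := ((hasDerivAt_id y).const_mul c).exp
      have := ((hexp.mul (hasDerivAt_diniFun hμ h₁)).div (hasDerivAt_diniFun hν h₂) h₂)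
      refine (this.congr_deriv ?_).hasDerivWithinAt
      simp only [diniLogDiff, ← hc, id, mul_one, Pi.mul_apply]
      field_simp
      ring
    · intro y hy
      rw [interior_Icc] at hy
      have hy' : y ∈ Set.Ico 0 B := ⟨hy.1.le, hy.2⟩
      have h₁ := hμpos y hy'
      have h₂ := hνpos y ⟨hy.1.le, hy.2.le⟩
      have h₃ : 0 ≤ diniLogDiff μ ν y := by
        simpa using iteratedDeriv_nonneg_of_analytic
          (fun w hw => analyticAt_diniLogDiff hμ hν (hμpos w hw).ne'
            (hνpos w ⟨hw.1, hw.2.le⟩).ne')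
          (iteratedDeriv_diniLogDiff_zero_nonneg hν hμν) hy' 0
      positivity
  have h := hmono ⟨le_rfl, hB0⟩ ⟨hB0, le_rfl⟩ hB0
  have hB' : diniFun μ B = 0 := hB
  norm_num [diniFun_zero hμ, diniFun_zero hν, hB'] at h

theorem log_dini_quotient (hμ : -1 < μ) (hν : -1 < ν) {s : ℝ} (hs : 0 < s)
    (hμs : 0 < diniFun μ s) (hνs : 0 < diniFun ν s) :
    Real.log (s ^ ((ν - μ) / 2) * Real.exp (3 * s / 4 * (1 / (μ + 1) - 1 / (ν + 1))) *
        dini μ (√s) / dini ν (√s)) =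
      Real.log (2 ^ ν * Real.Gamma (ν + 1) / (2 ^ μ * Real.Gamma (μ + 1))) +
        (3 / 4 * (1 / (μ + 1) - 1 / (ν + 1)) * s +
          (Real.log (diniFun μ s) - Real.log (diniFun ν s))) := by
  have hGμ : 0 < Real.Gamma (μ + 1) := Real.Gamma_pos_of_pos (by linarith)
  have hGν : 0 < Real.Gamma (ν + 1) := Real.Gamma_pos_of_pos (by linarith)
  have h2μ : (0 : ℝ) < 2 ^ μ := Real.rpow_pos_of_pos two_pos μ
  have h2ν : (0 : ℝ) < 2 ^ ν := Real.rpow_pos_of_pos two_pos ν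
  have hsν : 0 < s ^ (ν / 2) := Real.rpow_pos_of_pos hs _
  have hpow : s ^ ((ν - μ) / 2) * s ^ (μ / 2) = s ^ (ν / 2) := by
    rw [← Real.rpow_add hs]
    ring_nf
  rw [← Real.log_div hμs.ne' hνs.ne', ← Real.log_exp (3 / 4 * (1 / (μ + 1) - 1 / (ν + 1)) * s),
    ← Real.log_mul (by positivity) (by positivity), ← Real.log_mul (by positivity) (by positivity),
    dini_sqrt hμ hs, dini_sqrt hν hs, ← hpow,
    show 3 * s / 4 * (1 / (μ + 1) - 1 / (ν + 1)) =
      3 / 4 * (1 / (μ + 1) - 1 / (ν + 1)) * s by ring]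
  have hsμ : 0 < s ^ (μ / 2) := Real.rpow_pos_of_pos hs _
  have hsμν : 0 < s ^ ((ν - μ) / 2) := Real.rpow_pos_of_pos hs _
  congr 1
  field_simp

theorem hasDerivAt_log_diniFun_sub (hμ : -1 < μ) (hν : -1 < ν) {s : ℝ} (hμs : diniFun μ s ≠ 0)
    (hνs : diniFun ν s ≠ 0) (K : ℝ) :
    HasDerivAt (fun s => K + (3 / 4 * (1 / (μ + 1) - 1 / (ν + 1)) * s +
      (Real.log (diniFun μ s) - Real.log (diniFun ν s)))) (diniLogDiff μ ν s) s := by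
  have h := (((hasDerivAt_id s).const_mul (3 / 4 * (1 / (μ + 1) - 1 / (ν + 1)))).add
    (((hasDerivAt_diniFun hμ hμs).log hμs).sub ((hasDerivAt_diniFun hν hνs).log hνs))).const_add K
  refine h.congr_deriv ?_
  rw [diniLogDiff]
  field_simp
  ring

end Analytic

/-- If `G` agrees with a function `F` on `(a, b)` and `F` has derivative `0` at `a`, then the
one-sided derivative of `G` at `a` is `0`, whatever the value `G a`. -/
theorem derivWithin_Ico_left_eq_zero {F G : ℝ → ℝ} {a b : ℝ} (hab : a < b)
    (hFG : ∀ x ∈ Set.Ioo a b, G x = F x) (hF : HasDerivAt F 0 a) :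
    derivWithin G (Set.Ico a b) a = 0 := by
  by_cases hG : DifferentiableWithinAt ℝ G (Set.Ico a b) a
  · have hev : G =ᶠ[nhdsWithin a (Set.Ioi a)] F := by
      filter_upwards [Ioo_mem_nhdsGT hab] with x hx using hFG x hx
    have hGlim : Filter.Tendsto G (nhdsWithin a (Set.Ioi a)) (nhds (G a)) := by
      refine hG.continuousWithinAt.tendsto.mono_left ?_
      rw [← nhdsWithin_Ioo_eq_nhdsGT hab]
      exact nhdsWithin_mono _ Set.Ioo_subset_Ico_self
    have hFlim : Filter.Tendsto F (nhdsWithin a (Set.Ioi a)) (nhds (F a)) :=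
      hF.continuousAt.tendsto.mono_left nhdsWithin_le_nhds
    have haeq : G a = F a := tendsto_nhds_unique (hGlim.congr' hev) hFlim
    have hcongr : Set.EqOn G F (Set.Ico a b) := fun x hx => by
      rcases hx.1.eq_or_lt with rfl | h
      · exact haeq
      · exact hFG x ⟨h, hx.2⟩
    rw [derivWithin_congr hcongr haeq]
    exact hF.hasDerivWithinAt.derivWithin (uniqueDiffOn_Ico a b a ⟨le_rfl, hab⟩)
  · exact derivWithin_zero_of_not_differentiableWithinAt hG

/-- Let `μ ≥ ν > -1` and let `a1 = α_{ν,1}` be the first positive zero of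
the Dini function `d_ν`.  Then the function
`f_{μ,ν}(x) = (d/dx) log( x^{(ν-μ)/2} e^{(3x/4)(1/(μ+1) - 1/(ν+1))} d_μ(√x) / d_ν(√x) )`
is absolutely monotonic on `[0, a1²)`: all of its derivatives (within `[0, a1²)`) are
nonnegative there. -/
theorem absolutely_monotonic_f (μ ν : ℝ) (hν : -1 < ν) (hμν : ν ≤ μ)
    (a1 : ℝ) (ha1pos : 0 < a1) (ha1zero : dini ν a1 = 0)
    (ha1min : ∀ y : ℝ, 0 < y → dini ν y = 0 → a1 ≤ y) :
    ∀ m : ℕ, ∀ x ∈ Set.Ico (0 : ℝ) (a1 ^ 2),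
      0 ≤ iteratedDerivWithin m
        (fun t : ℝ => derivWithin
          (fun s : ℝ => Real.log (s ^ ((ν - μ) / 2) *
            Real.exp (3 * s / 4 * (1 / (μ + 1) - 1 / (ν + 1))) *
            dini μ (Real.sqrt s) / dini ν (Real.sqrt s)))
          (Set.Ico (0 : ℝ) (a1 ^ 2)) t)
        (Set.Ico (0 : ℝ) (a1 ^ 2)) x := by
  have hμ : -1 < μ := by linarith
  have hA : 0 < a1 ^ 2 := by positivity
  have hνpos : ∀ x ∈ Set.Ico 0 (a1 ^ 2), 0 < diniFun ν x := fun x hx => by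
    refine pos_of_ne_zero_on_Ico (continuous_diniFun hν) (by simp [diniFun_zero hν]) ?_ hx
    intro y hy hy0
    rcases hy.1.eq_or_lt with rfl | h
    · simp [diniFun_zero hν] at hy0
    · have hle := ha1min (√y) (Real.sqrt_pos.mpr h) (by rw [dini_sqrt hν h, hy0, mul_zero])
      exact hy.2.not_ge ((Real.le_sqrt ha1pos.le h.le).mp hle)
  have hμpos : ∀ x ∈ Set.Ico 0 (a1 ^ 2), 0 < diniFun μ x := fun x hx =>
    diniFun_pos_of_le hν hμν hνpos hx
  have han : ∀ x ∈ Set.Ico 0 (a1 ^ 2), AnalyticAt ℝ (diniLogDiff μ ν) x := fun x hx =>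
    analyticAt_diniLogDiff hμ hν (hμpos x hx).ne' (hνpos x hx).ne'
  have heq : Set.EqOn
      (fun t : ℝ => derivWithin
        (fun s : ℝ => Real.log (s ^ ((ν - μ) / 2) *
          Real.exp (3 * s / 4 * (1 / (μ + 1) - 1 / (ν + 1))) *
          dini μ (Real.sqrt s) / dini ν (Real.sqrt s)))
        (Set.Ico (0 : ℝ) (a1 ^ 2)) t) (diniLogDiff μ ν) (Set.Ico 0 (a1 ^ 2)) := by
    intro t ht
    have hF := hasDerivAt_log_diniFun_sub hμ hν (hμpos t ht).ne' (hνpos t ht).ne'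
      (Real.log (2 ^ ν * Real.Gamma (ν + 1) / (2 ^ μ * Real.Gamma (μ + 1))))
    have hGF : ∀ s ∈ Set.Ioo 0 (a1 ^ 2), _ := fun s hs =>
      log_dini_quotient hμ hν hs.1 (hμpos s ⟨hs.1.le, hs.2⟩) (hνpos s ⟨hs.1.le, hs.2⟩)
    rcases ht.1.eq_or_lt with rfl | h
    · rw [diniLogDiff_zero hμ hν] at hF ⊢
      exact derivWithin_Ico_left_eq_zero hA hGF hF
    · refine HasDerivWithinAt.derivWithin ?_ (uniqueDiffOn_Ico 0 (a1 ^ 2) t ht)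
      refine (hF.congr_of_eventuallyEq ?_).hasDerivWithinAt
      filter_upwards [Ioo_mem_nhds h ht.2] with s hs using hGF s hs
  intro m x hx
  rw [iteratedDerivWithin_congr heq hx,
    iteratedDerivWithin_eq_iteratedDeriv (uniqueDiffOn_Ico 0 (a1 ^ 2)) (han x hx).contDiffAt hx]
  exact iteratedDeriv_nonneg_of_analytic han (iteratedDeriv_diniLogDiff_zero_nonneg hν hμν) hx m
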